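/- arXiv:2208.10331 — 2 statements merged into one kernel-verified Lean document; each statement's English description precedes it below -/
import Mathlib

section
/- The character probability measure μ_{n,k}(λ) = s_λ(x_1,...,x_n) s_{λ̄'}(y_1,...,y_k) / Π_{i=1}^n Π_{j=1}^k (x_i + y_j), defined on partitions λ contained in the n×k rectangle with λ̄' the complement conjugate diagram, is a probability measure: all values are nonnegative and they sum to 1, provided all x_i, y_j > 0. -/
/-- q-integer `[m]_q = (1-q^m)/(1-q)`. -/
noncomputable def qnum (q : ℝ) (m : ℕ) : ℝ := (1 - q ^ m) / (1 - q)

/-- q-factorial `[m]_q!`. -/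
noncomputable def qfact (q : ℝ) (m : ℕ) : ℝ := ∏ j ∈ Finset.range m, qnum q (j + 1)

/-- Schur polynomial (bialternant formula): ratio of the generalized Vandermonde
determinant with exponents `a_i = λ_i + n - i` to the Vandermonde determinant. -/
noncomputable def schur (n : ℕ) (lam : Fin n → ℕ) (x : Fin n → ℝ) : ℝ :=
  Matrix.det (Matrix.of fun i j : Fin n => x j ^ (lam i + (n - 1 - (i : ℕ)))) /
    Matrix.det (Matrix.of fun i j : Fin n => x j ^ (n - 1 - (i : ℕ)))

/-- Conjugate partition: `λ´_j = #{i : λ_i > j}` (0-indexed `j`). -/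
noncomputable def conj (n k : ℕ) (lam : Fin n → ℕ) (j : Fin k) : ℕ :=
  (Finset.univ.filter (fun i : Fin n => (j : ℕ) < lam i)).card

lemma aux_signVar_lt : ∀ (m : ℕ) (P : Polynomial ℝ), P.support.card = m → P ≠ 0 →
    P.signVariations < m := by
  intro m
  induction m with
  | zero =>
    intro P h hP
    simp_all
  | succ m ih =>
    intro P h hP
    by_cases h0 : P.eraseLead = 0
    · have h1 := Polynomial.eraseLead_add_monomial_natDegree_leadingCoeff P
      rw [h0, zero_add] at h1
      rw [← h1, Polynomial.signVariations_monomial]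
      omega
    · have h1 := Polynomial.signVariations_le_eraseLead_succ P
      have h2 := ih P.eraseLead (Polynomial.card_support_eraseLead' h) h0
      omega

lemma aux_pos_roots {m : ℕ} (P : Polynomial ℝ) (hP : P ≠ 0) (z : Fin m → ℝ)
    (hz : Function.Injective z) (hpos : ∀ i, 0 < z i) (hr : ∀ i, P.eval (z i) = 0) :
    m < P.support.card := by
  have h1 := aux_signVar_lt _ P rfl hP
  have h2 := Polynomial.roots_countP_pos_le_signVariations P
  have h3 : m ≤ P.roots.countP (0 < ·) := by
    rw [Multiset.countP_eq_card_filter]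
    have h4 : (Finset.univ.image z).val ≤ P.roots.filter (0 < ·) := by
      rw [Multiset.le_iff_subset (Finset.nodup _)]
      intro t ht
      rw [Finset.mem_val, Finset.mem_image] at ht
      obtain ⟨i, -, rfl⟩ := ht
      rw [Multiset.mem_filter, Polynomial.mem_roots hP]
      exact ⟨hr i, hpos i⟩
    have h5 := Multiset.card_le_card h4
    rw [Finset.card_val, Finset.card_image_of_injective _ hz] at h5
    simpa using h5
  omega

lemma aux_det_pos : ∀ (n : ℕ) (x : Fin n → ℝ) (a : Fin n → ℕ), StrictMono x → (∀ i, 0 < x i) →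
    StrictMono a → 0 < Matrix.det (Matrix.of fun i j : Fin n => x j ^ a i) := by
  intro n
  induction n with
  | zero => intro x a _ _ _; simp
  | succ n ih =>
    intro x a hx hpos ha
    rcases Nat.eq_zero_or_pos n with hn | hn
    · subst hn
      rw [Matrix.det_fin_one]
      simpa using pow_pos (hpos 0) _
    set c : Fin (n + 1) → ℝ := fun i => (-1) ^ ((i : ℕ) + n) *
      Matrix.det (Matrix.of fun p q : Fin n => x (Fin.castSucc q) ^ a (i.succAbove p)) with hc
    set P : Polynomial ℝ := ∑ i, Polynomial.monomial (a i) (c i) with hPdef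
    have heval : ∀ t : ℝ, P.eval t = Matrix.det (Matrix.of fun i j : Fin (n + 1) =>
        (Fin.snoc (fun q : Fin n => x q.castSucc) t : Fin (n + 1) → ℝ) j ^ a i) := by
      intro t
      rw [Matrix.det_succ_column _ (Fin.last n), hPdef, Polynomial.eval_finsetSum]
      refine Finset.sum_congr rfl fun i _ => ?_
      rw [Polynomial.eval_monomial, hc]
      have : (Matrix.of fun i j : Fin (n + 1) =>
        (Fin.snoc (fun q : Fin n => x q.castSucc) t : Fin (n + 1) → ℝ) j ^ a i).submatrix
          i.succAbove (Fin.last n).succAbove =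
          Matrix.of fun p q : Fin n => x (Fin.castSucc q) ^ a (i.succAbove p) := by
        ext p q
        simp
      rw [this]
      simp only [Matrix.of_apply, Fin.snoc_last, Fin.val_last]
      ring
    have hclast : 0 < c (Fin.last n) := by
      rw [hc]
      have := ih (fun q => x q.castSucc) (fun p => a p.castSucc)
        (hx.comp Fin.strictMono_castSucc) (fun i => hpos _) (ha.comp Fin.strictMono_castSucc)
      simp only [Fin.val_last, ← two_mul, pow_mul, Fin.succAbove_last]
      simpa using this
    have hcoeff : P.coeff (a (Fin.last n)) = c (Fin.last n) := by
      rw [hPdef, Polynomial.finsetSum_coeff]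
      simp [Polynomial.coeff_monomial, ha.injective.eq_iff]
    have hP0 : P ≠ 0 := by
      intro h
      rw [h] at hcoeff
      simp at hcoeff
      exact hclast.ne hcoeff
    have hdeg : P.natDegree = a (Fin.last n) := by
      apply le_antisymm
      · apply Polynomial.natDegree_sum_le_of_forall_le
        intro i _
        exact (Polynomial.natDegree_monomial_le _).trans (ha.monotone (Fin.le_last i))
      · apply Polynomial.le_natDegree_of_ne_zero
        rw [hcoeff]; exact hclast.ne'
    have hsupp : P.support.card ≤ n + 1 := by
      have : P.support ⊆ Finset.univ.image a := by
        intro d hd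
        rw [Polynomial.mem_support_iff, hPdef, Polynomial.finsetSum_coeff] at hd
        obtain ⟨i, _, hi⟩ := Finset.exists_ne_zero_of_sum_ne_zero hd
        rw [Polynomial.coeff_monomial] at hi
        simp only [Finset.mem_image, Finset.mem_univ, true_and]
        exact ⟨i, by by_contra h; simp [h] at hi⟩
      refine (Finset.card_le_card this).trans ?_
      refine Finset.card_image_le.trans ?_
      simp
    have hroot : ∀ q : Fin n, P.eval (x q.castSucc) = 0 := by
      intro q
      rw [heval]
      apply Matrix.det_zero_of_column_eq (i := q.castSucc) (j := Fin.last n)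
        (Fin.castSucc_lt_last q).ne
      intro k
      simp
    have hmain : 0 < P.eval (x (Fin.last n)) := by
      by_contra hcon
      push Not at hcon
      have htend : Filter.Tendsto (fun t => P.eval t) Filter.atTop Filter.atTop := by
        apply Polynomial.tendsto_atTop_of_leadingCoeff_nonneg
        · rw [← Polynomial.natDegree_pos_iff_degree_pos, hdeg]
          have : a 0 < a (Fin.last n) := ha (by rw [Fin.lt_def]; simpa using hn)
          omega
        · rw [Polynomial.leadingCoeff, hdeg, hcoeff]; exact hclast.le
      obtain ⟨T, hT1, hT2⟩ := ((htend.eventually_ge_atTop 0).and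
        (Filter.eventually_ge_atTop (x (Fin.last n)))).exists
      obtain ⟨r, hr1, hr2⟩ := intermediate_value_Icc hT2 (P.continuous.continuousOn)
        (show (0 : ℝ) ∈ Set.Icc _ _ from ⟨hcon, hT1⟩)
      have hlt : ∀ q : Fin n, x q.castSucc < r := fun q =>
        (hx (Fin.castSucc_lt_last q)).trans_le hr1.1
      have hfin := aux_pos_roots P hP0 (Fin.snoc (fun q : Fin n => x q.castSucc) r : Fin (n+1) → ℝ)
        (by
          rw [Fin.snoc_injective_iff]
          refine ⟨hx.injective.comp (Fin.castSucc_injective n), ?_⟩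
          rintro ⟨q, hq⟩
          exact (hlt q).ne hq)
        (by
          intro i
          refine Fin.lastCases ?_ (fun q => ?_) i
          · simpa using (hpos _).trans_le hr1.1
          · simpa using hpos _)
        (by
          intro i
          refine Fin.lastCases ?_ (fun q => ?_) i
          · simpa using hr2
          · simpa using hroot q)
      omega
    rw [heval] at hmain
    convert hmain using 4 with i j
    ext j
    refine Fin.lastCases ?_ (fun q => ?_) j <;> simp

lemma aux_ratio_pos (n : ℕ) (x : Fin n → ℝ) (a b : Fin n → ℕ) (hx : Function.Injective x)
    (hpos : ∀ i, 0 < x i) (ha : StrictAnti a) (hb : StrictAnti b) :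
    0 < Matrix.det (Matrix.of fun i j : Fin n => x j ^ a i) /
      Matrix.det (Matrix.of fun i j : Fin n => x j ^ b i) := by
  have key : ∀ a : Fin n → ℕ, StrictAnti a → 0 < ((Equiv.Perm.sign (Tuple.sort x) : ℤ) : ℝ) *
      (((Equiv.Perm.sign (Fin.revPerm : Equiv.Perm (Fin n)) : ℤ) : ℝ) *
        Matrix.det (Matrix.of fun i j : Fin n => x j ^ a i)) := by
    intro a ha
    rw [← Matrix.det_permute, ← Matrix.det_permute']
    have := aux_det_pos n (x ∘ Tuple.sort x) (a ∘ Fin.rev)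
      ((Tuple.monotone_sort x).strictMono_of_injective (hx.comp (Equiv.injective _)))
      (fun i => hpos _) (ha.comp Fin.rev_strictAnti)
    exact this
  have h1 := key a ha
  have h2 := key b hb
  have := div_pos h1 h2
  rwa [mul_div_mul_left _ _ (by rintro h; simp [h] at h1),
    mul_div_mul_left _ _ (by rintro h; simp [h] at h1)] at this

lemma aux_conj_iff {n k : ℕ} {f : Fin n → ℕ} (hf : Antitone f) (i : Fin n) (j : Fin k) :
    (j : ℕ) < f i ↔ (i : ℕ) < conj n k f j := by
  constructor
  · intro h
    have : Finset.Iic i ⊆ Finset.univ.filter (fun i : Fin n => (j : ℕ) < f i) := by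
      intro p hp
      simp only [Finset.mem_Iic] at hp
      simpa using h.trans_le (hf hp)
    have := Finset.card_le_card this
    rw [Fin.card_Iic] at this
    exact this
  · intro h
    by_contra hcon
    have : Finset.univ.filter (fun i : Fin n => (j : ℕ) < f i) ⊆ Finset.Iio i := by
      intro p hp
      simp only [Finset.mem_filter, Finset.mem_univ, true_and] at hp
      rw [Finset.mem_Iio]
      by_contra h2
      exact hcon (hp.trans_le (hf (not_lt.mp h2)))
    have := Finset.card_le_card this
    rw [Fin.card_Iio] at this
    exact absurd h (not_lt.mpr this)

lemma aux_conj_le {n k : ℕ} (f : Fin n → ℕ) (j : Fin k) : conj n k f j ≤ n := by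
  unfold conj
  exact (Finset.card_le_univ _).trans (by simp)

lemma aux_conj_anti {n k : ℕ} (f : Fin n → ℕ) : Antitone (conj n k f) := by
  intro j j' h
  unfold conj
  apply Finset.card_le_card
  intro p hp
  simp only [Finset.mem_filter, Finset.mem_univ, true_and] at hp ⊢
  exact lt_of_le_of_lt h hp

/-- exponents for the `x` variables -/
def auxA (n : ℕ) (f : Fin n → ℕ) (i : Fin n) : ℕ := f i + (n - 1 - (i : ℕ))

/-- exponents for the `y` variables -/
noncomputable def auxB (n k : ℕ) (f : Fin n → ℕ) (j : Fin k) : ℕ :=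
  (n - conj n k f (Fin.rev j)) + (k - 1 - (j : ℕ))

lemma auxA_anti {n : ℕ} {f : Fin n → ℕ} (hf : Antitone f) : StrictAnti (auxA n f) := by
  intro i j h
  have := hf h.le
  have h' : (i : ℕ) < j := h
  have := j.2
  unfold auxA
  omega

lemma auxB_anti {n k : ℕ} {f : Fin n → ℕ} : StrictAnti (auxB n k f) := by
  intro i j h
  have := aux_conj_anti (k := k) f (Fin.rev_le_rev.mpr h.le)
  have h' : (i : ℕ) < j := h
  have := j.2
  unfold auxB
  omega

lemma auxAB {n k : ℕ} {f : Fin n → ℕ} (hf : Antitone f) (i : Fin n) (j : Fin k) :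
    (((j.rev : Fin k) : ℕ) < f i ∧ auxB n k f j < auxA n f i) ∨
    (¬ ((j.rev : Fin k) : ℕ) < f i ∧ auxA n f i < auxB n k f j) := by
  have h := aux_conj_iff hf i j.rev
  have h1 := aux_conj_le f j.rev
  have h2 := Fin.val_rev j
  have := i.2
  have := j.2
  unfold auxA auxB
  by_cases h3 : ((j.rev : Fin k) : ℕ) < f i
  · left
    refine ⟨h3, ?_⟩
    have := h.mp h3
    omega
  · right
    refine ⟨h3, ?_⟩
    have := mt h.mpr h3
    omega

lemma auxA_lt {n k : ℕ} {f : Fin n → ℕ} (hk : ∀ i, f i ≤ k) (i : Fin n) : auxA n f i < n + k := by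
  have := hk i
  have := i.2
  unfold auxA
  omega

lemma auxB_lt {n k : ℕ} {f : Fin n → ℕ} (j : Fin k) : auxB n k f j < n + k := by
  have := j.2
  unfold auxB
  omega

/-- The shuffle attached to a partition, as a function. -/
noncomputable def auxFun {n k : ℕ} (f : Fin n → ℕ) (hk : ∀ i, f i ≤ k) :
    Fin n ⊕ Fin k → Fin (n + k) :=
  Sum.elim (fun i => ⟨auxA n f i, auxA_lt hk i⟩) (fun j => ⟨auxB n k f j, auxB_lt j⟩)

lemma auxFun_bij {n k : ℕ} (f : Fin n → ℕ) (hk : ∀ i, f i ≤ k) (hf : Antitone f) :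
    Function.Bijective (auxFun f hk) := by
  rw [Fintype.bijective_iff_injective_and_card]
  refine ⟨?_, by simp⟩
  rintro (i | i) (j | j) h
  · simp only [auxFun, Sum.elim_inl, Fin.mk.injEq] at h
    rw [(auxA_anti hf).injective h]
  · simp only [auxFun, Sum.elim_inl, Sum.elim_inr, Fin.mk.injEq] at h
    rcases auxAB hf i j with h1 | h1 <;> omega
  · simp only [auxFun, Sum.elim_inl, Sum.elim_inr, Fin.mk.injEq] at h
    rcases auxAB hf j i with h1 | h1 <;> omega
  · simp only [auxFun, Sum.elim_inr, Fin.mk.injEq] at h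
    rw [auxB_anti.injective h]

/-- The shuffle attached to a partition. -/
noncomputable def auxE {n k : ℕ} (f : Fin n → ℕ) (hk : ∀ i, f i ≤ k) (hf : Antitone f) :
    Fin n ⊕ Fin k ≃ Fin (n + k) := Equiv.ofBijective _ (auxFun_bij f hk hf)

lemma auxE_inl {n k : ℕ} (f : Fin n → ℕ) (hk : ∀ i, f i ≤ k) (hf : Antitone f) (i : Fin n) :
    ((auxE f hk hf (Sum.inl i) : Fin (n + k)) : ℕ) = auxA n f i := rfl

lemma auxE_inr {n k : ℕ} (f : Fin n → ℕ) (hk : ∀ i, f i ≤ k) (hf : Antitone f) (j : Fin k) :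
    ((auxE f hk hf (Sum.inr j) : Fin (n + k)) : ℕ) = auxB n k f j := rfl

/-- sign constant -/
def auxC (n : ℕ) : ℝ := ∏ i : Fin n, ∏ _j ∈ Finset.Ioi i, (-1 : ℝ)

lemma aux_prod_Ioi_add {n k : ℕ} (g : Fin (n + k) → Fin (n + k) → ℝ) :
    ∏ p, ∏ q ∈ Finset.Ioi p, g p q =
      (∏ i : Fin n, ∏ j ∈ Finset.Ioi i, g (Fin.castAdd k i) (Fin.castAdd k j)) *
      (∏ i : Fin n, ∏ j : Fin k, g (Fin.castAdd k i) (Fin.natAdd n j)) *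
      (∏ i : Fin k, ∏ j ∈ Finset.Ioi i, g (Fin.natAdd n i) (Fin.natAdd n j)) := by
  have hI : ∀ (m : ℕ) (p : Fin m), Finset.Ioi p = Finset.univ.filter (fun q => p < q) := by
    intro m p; ext; simp
  simp only [hI, Finset.prod_filter]
  rw [Fin.prod_univ_add]
  simp only [Fin.prod_univ_add]
  rw [Finset.prod_mul_distrib]
  congr 1
  · congr 1
    refine Finset.prod_congr rfl fun i _ => Finset.prod_congr rfl fun j _ => ?_
    rw [if_pos]
    rw [Fin.lt_def]; simp; omega
  · refine Finset.prod_congr rfl fun i _ => ?_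
    rw [Finset.prod_eq_one, one_mul]
    · simp
    · intro j _
      rw [if_neg]
      rw [Fin.lt_def]; simp; omega

lemma aux_sign {m : ℕ} (σ : Equiv.Perm (Fin m)) : ((Equiv.Perm.sign σ : ℤ) : ℝ) =
    ∏ i, ∏ j ∈ Finset.Ioi i, (if σ i < σ j then (1 : ℝ) else -1) := by
  rw [Equiv.Perm.sign_eq_prod_prod_Ioi]
  push_cast
  refine Finset.prod_congr rfl fun i _ => Finset.prod_congr rfl fun j _ => ?_
  split_ifs <;> simp

lemma aux_sign_rev (m : ℕ) :
    ((Equiv.Perm.sign (Fin.revPerm : Equiv.Perm (Fin m)) : ℤ) : ℝ) = auxC m := by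
  rw [aux_sign, auxC]
  refine Finset.prod_congr rfl fun i _ => Finset.prod_congr rfl fun j hj => ?_
  rw [if_neg]
  simp only [Finset.mem_Ioi] at hj
  simpa using hj.le

lemma auxC_sq (m : ℕ) : auxC m * auxC m = 1 := by
  rw [auxC, ← Finset.prod_mul_distrib]
  refine Finset.prod_eq_one fun i _ => ?_
  rw [← Finset.prod_mul_distrib]
  refine Finset.prod_eq_one fun j _ => ?_
  norm_num

lemma auxC_eq (m : ℕ) : auxC m = ∏ j : Fin m, (-1 : ℝ) ^ ((j.rev : Fin m) : ℕ) := by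
  rw [auxC]
  refine Finset.prod_congr rfl fun i _ => ?_
  rw [Finset.prod_const, Fin.card_Ioi, Fin.val_rev]
  congr 1
  omega

/-- Vandermonde in the reversed order. -/
lemma aux_vand (m : ℕ) (x : Fin m → ℝ) :
    Matrix.det (Matrix.of fun i j : Fin m => x j ^ (m - 1 - (i : ℕ))) =
      auxC m * ∏ i, ∏ j ∈ Finset.Ioi i, (x j - x i) := by
  rw [← Matrix.det_vandermonde, ← Matrix.det_transpose (Matrix.vandermonde x), ← aux_sign_rev,
    ← Matrix.det_permute]
  congr 1
  ext i j
  simp only [Matrix.of_apply, Matrix.submatrix_apply, Matrix.transpose_apply,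
    Matrix.vandermonde_apply, Fin.revPerm_apply, Fin.val_rev, id]
  congr 1
  omega

lemma aux_sign_E {n k : ℕ} (f : Fin n → ℕ) (hk : ∀ i, f i ≤ k) (hf : Antitone f) :
    ((Equiv.Perm.sign (finSumFinEquiv.symm.trans (auxE f hk hf)) : ℤ) : ℝ) *
      ∏ j : Fin k, (-1 : ℝ) ^ auxB n k f j = auxC n * (-1) ^ (n * k) := by
  rw [aux_sign, aux_prod_Ioi_add]
  have h1 : (∏ i : Fin n, ∏ j ∈ Finset.Ioi i,
      (if (finSumFinEquiv.symm.trans (auxE f hk hf)) (Fin.castAdd k i) <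
        (finSumFinEquiv.symm.trans (auxE f hk hf)) (Fin.castAdd k j) then (1 : ℝ) else -1))
      = auxC n := by
    refine Finset.prod_congr rfl fun i _ => Finset.prod_congr rfl fun j hj => ?_
    rw [if_neg]
    simp only [Finset.mem_Ioi] at hj
    simp only [Equiv.trans_apply, finSumFinEquiv_symm_apply_castAdd, Fin.lt_def, auxE_inl]
    exact (auxA_anti hf hj).le.not_gt
  have h2 : (∏ i : Fin k, ∏ j ∈ Finset.Ioi i,
      (if (finSumFinEquiv.symm.trans (auxE f hk hf)) (Fin.natAdd n i) <
        (finSumFinEquiv.symm.trans (auxE f hk hf)) (Fin.natAdd n j) then (1 : ℝ) else -1))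
      = auxC k := by
    refine Finset.prod_congr rfl fun i _ => Finset.prod_congr rfl fun j hj => ?_
    rw [if_neg]
    simp only [Finset.mem_Ioi] at hj
    simp only [Equiv.trans_apply, finSumFinEquiv_symm_apply_natAdd, Fin.lt_def, auxE_inr]
    exact (auxB_anti hj).le.not_gt
  have h3 : (∏ i : Fin n, ∏ j : Fin k,
      (if (finSumFinEquiv.symm.trans (auxE f hk hf)) (Fin.castAdd k i) <
        (finSumFinEquiv.symm.trans (auxE f hk hf)) (Fin.natAdd n j) then (1 : ℝ) else -1))
      = ∏ j : Fin k, (-1 : ℝ) ^ conj n k f j.rev := by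
    rw [Finset.prod_comm]
    refine Finset.prod_congr rfl fun j _ => ?_
    rw [conj, ← Finset.prod_const, Finset.prod_filter]
    refine Finset.prod_congr rfl fun i _ => ?_
    simp only [Equiv.trans_apply, finSumFinEquiv_symm_apply_castAdd,
      finSumFinEquiv_symm_apply_natAdd, Fin.lt_def, auxE_inl, auxE_inr]
    rcases auxAB hf i j with ⟨h, h'⟩ | ⟨h, h'⟩
    · rw [if_pos h, if_neg h'.le.not_gt]
    · rw [if_neg h, if_pos h']
  rw [h1, h2, h3]
  have h4 : (∏ j : Fin k, (-1 : ℝ) ^ conj n k f j.rev) * ∏ j : Fin k, (-1 : ℝ) ^ auxB n k f j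
      = (-1) ^ (n * k) * auxC k := by
    have : ((-1 : ℝ)) ^ (n * k) = ∏ _j : Fin k, (-1 : ℝ) ^ n := by
      simp [pow_mul]
    rw [this, auxC_eq, ← Finset.prod_mul_distrib, ← Finset.prod_mul_distrib]
    refine Finset.prod_congr rfl fun j _ => ?_
    rw [← pow_add, ← pow_add]
    congr 1
    have := aux_conj_le f j.rev
    have := Fin.val_rev j
    unfold auxB
    omega
  calc _ = auxC n * auxC k * ((∏ j : Fin k, (-1 : ℝ) ^ conj n k f j.rev) *
        ∏ j : Fin k, (-1 : ℝ) ^ auxB n k f j) := by ring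
    _ = auxC n * (-1) ^ (n * k) * (auxC k * auxC k) := by rw [h4]; ring
    _ = _ := by rw [auxC_sq, mul_one]

/-- Partitions in the rectangle. -/
abbrev auxPart (n k : ℕ) : Type :=
  {f : Fin n → Fin (k + 1) // Antitone fun i => ((f i : ℕ))}

/-- Shuffle of a partition in the rectangle. -/
noncomputable def auxS {n k : ℕ} (f : auxPart n k) : Fin n ⊕ Fin k ≃ Fin (n + k) :=
  auxE (fun i => (f.1 i : ℕ)) (fun i => Nat.lt_succ_iff.mp (f.1 i).2) f.2

lemma auxS_surj {n k : ℕ} (e : Fin n ⊕ Fin k ≃ Fin (n + k)) :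
    ∃ (f : auxPart n k) (σ : Equiv.Perm (Fin n)) (τ : Equiv.Perm (Fin k)),
      (Equiv.sumCongr σ τ).trans (auxS f) = e := by
  set u : Fin n → ℕ := fun i => (e (Sum.inl i) : ℕ) with hu
  have huinj : Function.Injective u := fun i j h => by
    have := e.injective (Fin.ext h)
    simpa using this
  set ρ : Equiv.Perm (Fin n) := Fin.revPerm.trans (Tuple.sort u) with hρ
  have ha : StrictAnti (u ∘ ρ) := by
    have := (Tuple.monotone_sort u).strictMono_of_injective (huinj.comp (Equiv.injective _))
    exact this.comp_strictAnti Fin.rev_strictAnti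
  have step : ∀ (d : ℕ) (i j : Fin n), (j : ℕ) = i + d → u (ρ j) + d ≤ u (ρ i) := by
    intro d
    induction d with
    | zero => intro i j h; have : j = i := Fin.ext (by omega)
              subst this; omega
    | succ d ih =>
      intro i j h
      have hj := j.2
      have h1 := ih i ⟨i + d, by omega⟩ rfl
      have h2 : u (ρ j) < u (ρ ⟨i + d, by omega⟩) := ha (by rw [Fin.lt_def]; simp; omega)
      omega
  have hlow : ∀ i : Fin n, n - 1 - (i : ℕ) ≤ u (ρ i) := by
    intro i
    have hi := i.2
    have := step (n - 1 - i) i ⟨n - 1, by omega⟩ (by simp; omega)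
    omega
  have hup : ∀ i : Fin n, u (ρ i) + i < n + k := by
    intro i
    have hi := i.2
    have := step i ⟨0, by omega⟩ i (by simp)
    have h2 : u (ρ ⟨0, by omega⟩) < n + k := (e _).2
    omega
  let f : auxPart n k := ⟨fun i => ⟨u (ρ i) - (n - 1 - i), by
    have := hup i; have := i.2; omega⟩, by
      intro i j h
      have h' : (i : ℕ) ≤ j := h
      have := step (j - i) i j (by omega)
      have := hlow i
      have := hlow j
      have := j.2
      simp only
      omega⟩
  have hf : ∀ i, auxS f (Sum.inl i) = e (Sum.inl (ρ i)) := by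
    intro i
    apply Fin.ext
    have := hlow i
    show u (ρ i) - (n - 1 - i) + (n - 1 - i) = u (ρ i)
    omega
  have hmem : (e.trans (auxS f).symm) ∈ (Equiv.Perm.sumCongrHom (Fin n) (Fin k)).range := by
    apply Equiv.Perm.mem_sumCongrHom_range_of_perm_mapsTo_inl
    rintro _ ⟨i, rfl⟩
    refine ⟨ρ.symm i, ?_⟩
    rw [Equiv.trans_apply, Equiv.eq_symm_apply, hf, Equiv.apply_symm_apply]
  obtain ⟨⟨σ, τ⟩, h⟩ := hmem
  refine ⟨f, σ, τ, ?_⟩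
  have h' : Equiv.sumCongr σ τ = e.trans (auxS f).symm := h
  rw [h']
  ext p
  simp

lemma auxS_inj {n k : ℕ} (f f' : auxPart n k) (σ σ' : Equiv.Perm (Fin n))
    (τ τ' : Equiv.Perm (Fin k))
    (h : (Equiv.sumCongr σ τ).trans (auxS f) = (Equiv.sumCongr σ' τ').trans (auxS f')) :
    f = f' ∧ σ = σ' ∧ τ = τ' := by
  have h1 : ∀ i, auxA n (fun i => (f.1 i : ℕ)) (σ i) = auxA n (fun i => (f'.1 i : ℕ)) (σ' i) :=
    fun i => congrArg Fin.val (congrArg (fun e => e (Sum.inl i)) h)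
  have hr : Set.range (auxA n (fun i => (f.1 i : ℕ))) =
      Set.range (auxA n (fun i => (f'.1 i : ℕ))) := by
    rw [← EquivLike.range_comp (auxA n (fun i => (f.1 i : ℕ))) σ,
      ← EquivLike.range_comp (auxA n (fun i => (f'.1 i : ℕ))) σ']
    congr 1
    funext i
    exact h1 i
  have h2 := Set.range_injOn_strictAnti (auxA_anti f.2) (auxA_anti f'.2) hr
  have hff : f = f' := by
    apply Subtype.ext
    funext i
    apply Fin.ext
    have := congrFun h2 i
    simp only [auxA] at this
    omega
  subst hff
  have h3 : Equiv.sumCongr σ τ = Equiv.sumCongr σ' τ' := by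
    ext p
    have := congrArg (fun e => e p) h
    exact (auxS f).injective this
  have h4 : (Equiv.Perm.sumCongrHom (Fin n) (Fin k)) (σ, τ) =
    (Equiv.Perm.sumCongrHom (Fin n) (Fin k)) (σ', τ') := h3
  have := Equiv.Perm.sumCongrHom_injective h4
  simpa using this

open Classical in
lemma aux_laplace (n k : ℕ) (x : Fin n → ℝ) (y : Fin k → ℝ) :
    ∑ f : auxPart n k,
      Matrix.det (Matrix.of fun i j : Fin n => x j ^ auxA n (fun i => (f.1 i : ℕ)) i) *
      Matrix.det (Matrix.of fun i j : Fin k => y j ^ auxB n k (fun i => (f.1 i : ℕ)) i) *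
      (auxC n * (-1) ^ (n * k)) =
    Matrix.det (Matrix.vandermonde (Fin.append x (fun j => - y j))) := by
  set z := Fin.append x (fun j => - y j) with hz
  rw [← Matrix.det_transpose (Matrix.vandermonde z), Matrix.det_apply']
  let F : (auxPart n k × Equiv.Perm (Fin n) × Equiv.Perm (Fin k)) → Equiv.Perm (Fin (n + k)) :=
    fun t => finSumFinEquiv.symm.trans ((Equiv.sumCongr t.2.1 t.2.2).trans (auxS t.1))
  have hF : Function.Bijective F := by
    constructor
    · rintro ⟨f, σ, τ⟩ ⟨f', σ', τ'⟩ h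
      have h' : (Equiv.sumCongr σ τ).trans (auxS f) = (Equiv.sumCongr σ' τ').trans (auxS f') := by
        ext p
        have := congrArg (fun e : Equiv.Perm (Fin (n + k)) => e (finSumFinEquiv p)) h
        simpa [F] using congrArg Fin.val this
      obtain ⟨rfl, rfl, rfl⟩ := auxS_inj _ _ _ _ _ _ h'
      rfl
    · intro e
      obtain ⟨f, σ, τ, h⟩ := auxS_surj (finSumFinEquiv.trans e)
      refine ⟨(f, σ, τ), ?_⟩
      simp only [F, h]
      ext p
      simp
  rw [← Function.Bijective.sum_comp hF, Fintype.sum_prod_type]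
  refine Finset.sum_congr rfl fun f _ => ?_
  rw [Fintype.sum_prod_type, Matrix.det_apply', Matrix.det_apply', Finset.sum_mul_sum,
    Finset.sum_mul]
  refine Finset.sum_congr rfl fun σ _ => ?_
  rw [Finset.sum_mul]
  refine Finset.sum_congr rfl fun τ _ => ?_
  have hs : Equiv.Perm.sign (F (f, σ, τ)) = Equiv.Perm.sign σ * Equiv.Perm.sign τ *
      Equiv.Perm.sign (finSumFinEquiv.symm.trans (auxS f)) := by
    have : F (f, σ, τ) = (finSumFinEquiv.symm.trans (auxS f)) *
        ((finSumFinEquiv.symm.trans (Equiv.sumCongr σ τ)).trans finSumFinEquiv) := by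
      ext p
      simp [F]
    rw [this, Equiv.Perm.sign_mul, Equiv.Perm.sign_symm_trans_trans, Equiv.Perm.sign_sumCongr]
    rw [mul_comm]
  have hp : ∏ p, (Matrix.vandermonde z).transpose (F (f, σ, τ) p) p =
      (∏ i, x i ^ auxA n (fun i => (f.1 i : ℕ)) (σ i)) *
      ((∏ j, y j ^ auxB n k (fun i => (f.1 i : ℕ)) (τ j)) *
        ∏ j, (-1 : ℝ) ^ auxB n k (fun i => (f.1 i : ℕ)) j) := by
    rw [Fin.prod_univ_add]
    congr 1
    · refine Finset.prod_congr rfl fun i _ => ?_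
      simp only [Matrix.transpose_apply, Matrix.vandermonde_apply, hz, Fin.append_left, F,
        Equiv.trans_apply, finSumFinEquiv_symm_apply_castAdd, Equiv.sumCongr_apply, Sum.map_inl]
      rfl
    · rw [← Equiv.prod_comp τ (fun j => (-1 : ℝ) ^ auxB n k (fun i => (f.1 i : ℕ)) j),
        ← Finset.prod_mul_distrib]
      refine Finset.prod_congr rfl fun j _ => ?_
      simp only [Matrix.transpose_apply, Matrix.vandermonde_apply, hz, Fin.append_right, F,
        Equiv.trans_apply, finSumFinEquiv_symm_apply_natAdd, Equiv.sumCongr_apply, Sum.map_inr]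
      rw [← mul_pow, mul_neg_one]
      rfl
  have hE := aux_sign_E (fun i => (f.1 i : ℕ)) (fun i => Nat.lt_succ_iff.mp (f.1 i).2) f.2
  rw [hp, hs, ← hE]
  simp only [Matrix.of_apply, auxS]
  push_cast
  ring

lemma aux_rhs (n k : ℕ) (x : Fin n → ℝ) (y : Fin k → ℝ) :
    Matrix.det (Matrix.vandermonde (Fin.append x (fun j => - y j))) =
      Matrix.det (Matrix.of fun i j : Fin n => x j ^ (n - 1 - (i : ℕ))) *
      Matrix.det (Matrix.of fun i j : Fin k => y j ^ (k - 1 - (i : ℕ))) *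
      (∏ i, ∏ j, (x i + y j)) * (auxC n * (-1) ^ (n * k)) := by
  rw [Matrix.det_vandermonde, aux_prod_Ioi_add, aux_vand, aux_vand]
  simp only [Fin.append_left, Fin.append_right]
  have h1 : ∏ i, ∏ j, (-y j - x i) = (-1) ^ (n * k) * ∏ i, ∏ j, (x i + y j) := by
    have : ((-1 : ℝ)) ^ (n * k) = ∏ _i : Fin n, ∏ _j : Fin k, (-1 : ℝ) := by
      simp [← pow_mul, mul_comm]
    rw [this, ← Finset.prod_mul_distrib]
    refine Finset.prod_congr rfl fun i _ => ?_
    rw [← Finset.prod_mul_distrib]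
    exact Finset.prod_congr rfl fun j _ => by ring
  have h2 : ∏ i, ∏ j ∈ Finset.Ioi i, (-y j - -y i) =
      auxC k * ∏ i, ∏ j ∈ Finset.Ioi i, (y j - y i) := by
    rw [auxC, ← Finset.prod_mul_distrib]
    refine Finset.prod_congr rfl fun i _ => ?_
    rw [← Finset.prod_mul_distrib]
    exact Finset.prod_congr rfl fun j _ => by ring
  rw [h1, h2]
  linear_combination (-(∏ i, ∏ j ∈ Finset.Ioi i, (x j - x i)) *
    ((-1) ^ (n * k) * ∏ i, ∏ j, (x i + y j)) *
    (auxC k * ∏ i, ∏ j ∈ Finset.Ioi i, (y j - y i))) * auxC_sq n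

open Classical in
/-- The character measure of skew Howe duality is a probability measure on
partitions in the n×k rectangle (encoded as antitone functions Fin n → Fin (k+1));
the complement conjugate diagram is given by j ↦ n - λ'_{k+1-j}. -/
theorem stmt6 (n k : ℕ) (x : Fin n → ℝ) (y : Fin k → ℝ)
    (hx : ∀ i, 0 < x i) (hy : ∀ j, 0 < y j)
    (hxinj : Function.Injective x) (hyinj : Function.Injective y)
    (mu : (Fin n → Fin (k + 1)) → ℝ)
    (hmu : ∀ f, mu f =
      schur n (fun i => (f i : ℕ)) x *
        schur k (fun j : Fin k => n - conj n k (fun i => (f i : ℕ)) (Fin.rev j)) y /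
        ∏ i : Fin n, ∏ j : Fin k, (x i + y j)) :
    (∀ f ∈ Finset.univ.filter
        (fun f : Fin n → Fin (k + 1) => Antitone fun i => ((f i : ℕ))), 0 ≤ mu f) ∧
    (∑ f ∈ Finset.univ.filter
        (fun f : Fin n → Fin (k + 1) => Antitone fun i => ((f i : ℕ))), mu f) = 1 := by

  have hstair : ∀ m : ℕ, StrictAnti (fun i : Fin m => m - 1 - (i : ℕ)) := by
    intro m i j h
    have h' : (i : ℕ) < j := h
    have := j.2
    simp only
    omega
  have hprod : 0 < ∏ i : Fin n, ∏ j : Fin k, (x i + y j) :=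
    Finset.prod_pos fun i _ => Finset.prod_pos fun j _ => add_pos (hx i) (hy j)
  constructor
  · intro f hf
    rw [Finset.mem_filter] at hf
    rw [hmu]
    refine div_nonneg (mul_nonneg ?_ ?_) hprod.le
    · exact (aux_ratio_pos n x _ _ hxinj hx (auxA_anti hf.2) (hstair n)).le
    · exact (aux_ratio_pos k y (auxB n k fun i => (f i : ℕ)) _ hyinj hy auxB_anti (hstair k)).le
  · have hvx : Matrix.det (Matrix.of fun i j : Fin n => x j ^ (n - 1 - (i : ℕ))) ≠ 0 := by
      intro h
      have := aux_ratio_pos n x _ _ hxinj hx (hstair n) (hstair n)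
      rw [h] at this
      simp at this
    have hvy : Matrix.det (Matrix.of fun i j : Fin k => y j ^ (k - 1 - (i : ℕ))) ≠ 0 := by
      intro h
      have := aux_ratio_pos k y _ _ hyinj hy (hstair k) (hstair k)
      rw [h] at this
      simp at this
    have hmain := (aux_laplace n k x y).trans (aux_rhs n k x y)
    rw [← Finset.sum_mul] at hmain
    have hc : auxC n * (-1) ^ (n * k) ≠ 0 := by
      refine mul_ne_zero ?_ (pow_ne_zero _ (by norm_num))
      intro h
      have := auxC_sq n
      rw [h] at this
      simp at this
    have hmain := mul_right_cancel₀ hc hmain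
    rw [Finset.sum_subtype (p := fun f : Fin n → Fin (k + 1) => Antitone fun i => ((f i : ℕ))) _
      (by simp)]
    have : ∀ f : auxPart n k, mu f.1 =
      Matrix.det (Matrix.of fun i j : Fin n => x j ^ auxA n (fun i => (f.1 i : ℕ)) i) *
      Matrix.det (Matrix.of fun i j : Fin k => y j ^ auxB n k (fun i => (f.1 i : ℕ)) i) /
      (Matrix.det (Matrix.of fun i j : Fin n => x j ^ (n - 1 - (i : ℕ))) *
      Matrix.det (Matrix.of fun i j : Fin k => y j ^ (k - 1 - (i : ℕ))) *
      (∏ i, ∏ j, (x i + y j))) := by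
      intro f
      rw [hmu, schur, schur, div_mul_div_comm, div_div]
      rfl
    rw [Finset.sum_congr rfl fun f _ => this f, ← Finset.sum_div, hmain]
    exact div_self (mul_ne_zero (mul_ne_zero hvx hvy) hprod.ne')
end

section
/- For 0 < q < 1 and positive integers n, k, the normalizing constant identity holds: Σ over partitions λ inside the n×k rectangle of q^{||λ||+||λ̄'||} Π_{1≤i<j≤n}[a_i-a_j]_q² · Π_{m=0}^{n-1}[k+m]_q! / (Π_{i<j}[j-i]_q Π_{i=1}^n [a_i]_q! [n+k-1-a_i]_q!) = Π_{i=1}^n Π_{j=1}^k (q^{i-1} + q^{j-1}), where a_i = λ_i + n - i. -/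
open Finset in
theorem cb_aux {α : Type*} [Fintype α] [DecidableEq α] {n : ℕ}
    (P : Matrix (Fin n) α ℝ) (R : Matrix α (Fin n) ℝ) :
    (P * R).det = ∑ p : Fin n → α, (∏ i, R (p i) i) * (P.submatrix id p).det := by
  simp only [Matrix.det_apply', Matrix.mul_apply, prod_univ_sum, mul_sum, Fintype.piFinset_univ]
  rw [Finset.sum_comm]
  refine sum_congr rfl fun p _ => sum_congr rfl fun σ _ => ?_
  simp only [prod_mul_distrib, Matrix.submatrix_apply, id]
  ring

open Finset Classical in
theorem cb {α : Type*} [Fintype α] [LinearOrder α] {n : ℕ}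
    (P : Matrix (Fin n) α ℝ) (R : Matrix α (Fin n) ℝ) :
    (P * R).det = ∑ s ∈ univ.filter (fun s : Fin n → α => StrictAnti s),
      (P.submatrix id s).det * (R.submatrix s id).det := by
  rw [cb_aux]
  have h1 : ∑ p : Fin n → α, (∏ i, R (p i) i) * (P.submatrix id p).det
      = ∑ p ∈ univ.filter (fun s : Fin n → α => Function.Injective s),
        (∏ i, R (p i) i) * (P.submatrix id p).det := by
    refine (sum_subset (filter_subset _ _) fun p _ hp => ?_).symm
    have hp' : ¬ Function.Injective p := fun h => hp (mem_filter.2 ⟨mem_univ _, h⟩)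
    simp only [Function.Injective, not_forall] at hp'
    obtain ⟨i, j, hij, hne⟩ := hp'
    rw [Matrix.det_zero_of_column_eq hne, mul_zero]
    intro l
    simp [hij]
  rw [h1]
  have h2 : ∀ s : Fin n → α, (P.submatrix id s).det * (R.submatrix s id).det =
      ∑ σ : Equiv.Perm (Fin n), (∏ i, R ((s ∘ σ) i) i) * (P.submatrix id (s ∘ σ)).det := by
    intro s
    rw [Matrix.det_apply' (R.submatrix s id), mul_sum]
    refine sum_congr rfl fun σ _ => ?_
    have := Matrix.det_permute' σ (P.submatrix id s)
    rw [Matrix.submatrix_submatrix] at this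
    simp only [Function.comp_id] at this
    rw [this]
    simp only [Matrix.submatrix_apply, id, Function.comp]
    ring
  simp only [h2]
  rw [← sum_product']
  symm
  refine sum_bij (fun x _ => x.1 ∘ x.2) ?_ ?_ ?_ ?_
  · rintro ⟨s, σ⟩ h
    simp only [mem_product, mem_filter, mem_univ, true_and, and_true] at h ⊢
    exact h.injective.comp σ.injective
  · rintro ⟨s, σ⟩ h ⟨s', σ'⟩ h' heq
    simp only [mem_product, mem_filter, mem_univ, true_and, and_true] at h h' heq
    have e : s = s' ∘ (σ' * σ⁻¹ : Equiv.Perm (Fin n)) := by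
      funext i
      have := congrFun heq (σ⁻¹ i)
      simpa using this
    have e2 : s = s' := by
      rw [e]
      refine (Tuple.unique_antitone (f := s') (σ := σ' * σ⁻¹) (τ := 1) ?_ ?_)
      · rw [← e]; exact h.antitone
      · exact h'.antitone
    subst e2
    have : σ = σ' := by
      ext i
      have := congrFun heq i
      exact congrArg _ (h.injective this)
    rw [this]
  · intro p hp
    simp only [mem_filter, mem_univ, true_and] at hp
    let τ : Equiv.Perm (Fin n) := Fin.revPerm.trans (Tuple.sort p)
    refine ⟨(p ∘ τ, τ⁻¹), ?_, ?_⟩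
    · simp only [mem_product, mem_filter, mem_univ, true_and, and_true]
      have hm : StrictMono (p ∘ Tuple.sort p) :=
        (Tuple.monotone_sort p).strictMono_of_injective (hp.comp (Tuple.sort p).injective)
      intro i j hij
      exact hm (Fin.rev_lt_rev.2 hij)
    · funext i; simp
  · rintro ⟨s, σ⟩ h
    rfl

theorem strictAnti_gap {n M : ℕ} (s : Fin n → Fin M) (hs : StrictAnti s) :
    ∀ d : ℕ, ∀ i j : Fin n, (j : ℕ) = i + d → (s j : ℕ) + d ≤ s i := by
  intro d
  induction d with
  | zero => intro i j h; have : j = i := Fin.ext h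
            simp [this]
  | succ d ih =>
    intro i j h
    have h1 := ih i ⟨i + d, by omega⟩ rfl
    have h2 : s j < s ⟨i + d, by omega⟩ := hs (by rw [Fin.lt_def]; simp; omega)
    rw [Fin.lt_def] at h2
    omega

open Finset Classical in
theorem reindex (n k N : ℕ) (hN : N + 1 = n + k) (F : (Fin n → ℕ) → ℝ) :
    ∑ f ∈ Finset.univ.filter
        (fun f : Fin n → Fin (k + 1) => Antitone fun i => ((f i : ℕ))),
        F (fun i => f i + (n - 1 - (i : ℕ)))
     = ∑ s ∈ univ.filter (fun s : Fin n → Fin (N + 1) => StrictAnti s), F (fun i => s i) := by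
  refine sum_bij (fun f _ i => ⟨f i + (n - 1 - (i : ℕ)), by omega⟩) ?_ ?_ ?_ ?_
  · intro f hf
    simp only [mem_filter, mem_univ, true_and] at hf ⊢
    intro i j hij
    have := hf hij.le
    rw [Fin.lt_def] at hij ⊢
    simp only at this ⊢
    omega
  · intro f _ g _ h
    funext i
    have := congrArg Fin.val (congrFun h i)
    simp only at this
    apply Fin.ext
    omega
  · intro s hs
    simp only [mem_filter, mem_univ, true_and] at hs
    have lo : ∀ i : Fin n, n - 1 - (i : ℕ) ≤ s i := by
      intro i
      have := strictAnti_gap s hs (n - 1 - i) i ⟨n - 1, by have := i.2; omega⟩ (by have := i.2; simp only; omega)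
      omega
    have hi : ∀ i : Fin n, (s i : ℕ) + i ≤ N := by
      intro i
      have := strictAnti_gap s hs i ⟨0, by have := i.2; omega⟩ i (by simp)
      omega
    refine ⟨fun i => ⟨s i - (n - 1 - i), by have := hi i; omega⟩, ?_, ?_⟩
    · simp only [mem_filter, mem_univ, true_and]
      intro i j hij
      rw [Fin.le_def] at hij
      have := strictAnti_gap s hs (j - i) i j (by omega)
      have := lo i
      have := lo j
      simp only
      omega
    · funext i
      apply Fin.ext
      have := lo i
      simp only
      omega
  · intro f _
    rfl

theorem qnum_pos {q : ℝ} (hq0 : 0 < q) (hq1 : q < 1) (m : ℕ) : 0 < qnum q (m + 1) := by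
  unfold qnum
  apply div_pos
  · have := pow_lt_one₀ hq0.le hq1 (Nat.succ_ne_zero m)
    simpa using this
  · linarith

theorem qfact_pos {q : ℝ} (hq0 : 0 < q) (hq1 : q < 1) (m : ℕ) : 0 < qfact q m :=
  Finset.prod_pos fun j _ => qnum_pos hq0 hq1 j

theorem qfact_succ (q : ℝ) (m : ℕ) : qfact q (m + 1) = qfact q m * qnum q (m + 1) :=
  Finset.prod_range_succ _ _

theorem choose_two_succ (c : ℕ) : (c + 1).choose 2 = c.choose 2 + c := by
  rw [Nat.choose_succ_succ' c 1, Nat.choose_one_right, add_comm]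

theorem qbinomial {q : ℝ} (hq0 : 0 < q) (hq1 : q < 1) (t : ℝ) (M : ℕ) :
    qfact q M * ∑ x ∈ Finset.HasAntidiagonal.antidiagonal M,
      q ^ (x.1.choose 2) * t ^ x.2 / (qfact q x.1 * qfact q x.2)
    = ∏ m ∈ Finset.range M, (t + q ^ m) := by
  have h1q : (1 - q) ≠ 0 := by linarith
  induction M with
  | zero => simp [qfact]
  | succ M ih =>
    rw [Finset.prod_range_succ, ← ih, qfact_succ, mul_assoc, mul_assoc]
    congr 1
    have key : qnum q (M + 1) * ∑ x ∈ Finset.HasAntidiagonal.antidiagonal (M + 1),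
      q ^ (x.1.choose 2) * t ^ x.2 / (qfact q x.1 * qfact q x.2) =
       ∑ x ∈ Finset.HasAntidiagonal.antidiagonal (M + 1), qnum q x.2 * 
         (q ^ (x.1.choose 2) * t ^ x.2 / (qfact q x.1 * qfact q x.2)) +
       ∑ x ∈ Finset.HasAntidiagonal.antidiagonal (M + 1), q ^ x.2 * qnum q x.1 * 
         (q ^ (x.1.choose 2) * t ^ x.2 / (qfact q x.1 * qfact q x.2)) := by
      rw [Finset.mul_sum, ← Finset.sum_add_distrib]
      refine Finset.sum_congr rfl fun x hx => ?_
      rw [Finset.HasAntidiagonal.mem_antidiagonal] at hx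
      rw [← add_mul]
      congr 1
      rw [← hx]
      unfold qnum
      field_simp
      ring
    rw [key, Finset.Nat.sum_antidiagonal_succ', Finset.Nat.sum_antidiagonal_succ]
    have z : qnum q 0 = 0 := by simp [qnum]
    simp only [z, zero_mul, mul_zero, zero_add, add_zero]
    rw [Finset.sum_mul, ← Finset.sum_add_distrib]
    refine Finset.sum_congr rfl fun x hx => ?_
    rw [Finset.HasAntidiagonal.mem_antidiagonal] at hx
    rw [← hx, qfact_succ, qfact_succ, choose_two_succ]
    have := (qfact_pos hq0 hq1 x.1).ne'
    have := (qfact_pos hq0 hq1 x.2).ne'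
    have := (qnum_pos hq0 hq1 x.1).ne'
    have := (qnum_pos hq0 hq1 x.2).ne'
    field_simp
    ring

theorem falling {q : ℝ} (hq0 : 0 < q) (hq1 : q < 1) (i d : ℕ) :
    (∏ r ∈ Finset.range i, (q ^ (i + d) - q ^ r)) * qfact q d
      = q ^ (i.choose 2) * (q - 1) ^ i * qfact q (i + d) := by
  induction i generalizing d with
  | zero => simp
  | succ i ih =>
    have h1q : (1 - q) ≠ 0 := by linarith
    have h := ih (d + 1)
    rw [Finset.prod_range_succ, choose_two_succ]
    rw [show i + 1 + d = i + (d + 1) by ring]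
    have e : q ^ (i + (d + 1)) - q ^ i = q ^ i * (q - 1) * qnum q (d + 1) := by
      unfold qnum; field_simp; ring
    rw [e]
    rw [qfact_succ] at h
    linear_combination (q ^ i * (q - 1)) * h

theorem entry {q : ℝ} (hq0 : 0 < q) (hq1 : q < 1) (N i j : ℕ) (hi : i ≤ N) :
    ∑ a : Fin (N + 1), (q ^ ((N - (a : ℕ)).choose 2) / (qfact q a * qfact q (N - a)) *
       ∏ r ∈ Finset.range i, (q ^ (a : ℕ) - q ^ r)) * (q ^ (a : ℕ)) ^ j
    = (q ^ (i.choose 2) * (q - 1) ^ i / qfact q (N - i)) *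
       ((q ^ j) ^ i * ∏ m ∈ Finset.range (N - i), (q ^ j + q ^ m)) := by
  rw [← qbinomial hq0 hq1]
  rw [Fin.sum_univ_eq_sum_range (fun a => (q ^ ((N - (a : ℕ)).choose 2) / (qfact q a * qfact q (N - a)) *
       ∏ r ∈ Finset.range i, (q ^ (a : ℕ) - q ^ r)) * (q ^ (a : ℕ)) ^ j)]
  rw [Finset.range_eq_Ico, ← Finset.sum_Ico_consecutive _ (Nat.zero_le i) (by omega : i ≤ N + 1)]
  rw [Finset.sum_eq_zero, zero_add, Finset.sum_Ico_eq_sum_range]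
  · rw [← Finset.Nat.sum_antidiagonal_swap, Finset.Nat.sum_antidiagonal_eq_sum_range_succ_mk]
    have := (qfact_pos hq0 hq1 (N - i)).ne'
    simp only [Prod.swap]
    rw [show q ^ i.choose 2 * (q - 1) ^ i / qfact q (N - i) *
      ((q ^ j) ^ i * (qfact q (N - i) * ∑ x ∈ Finset.range (N - i).succ,
       q ^ (N - i - x).choose 2 * (q ^ j) ^ x / (qfact q (N - i - x) * qfact q x))) =
        (q ^ i.choose 2 * (q - 1) ^ i * (q ^ j) ^ i) * ∑ x ∈ Finset.range (N - i).succ,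
       q ^ (N - i - x).choose 2 * (q ^ j) ^ x / (qfact q (N - i - x) * qfact q x) by field_simp]
    rw [Finset.mul_sum, show N + 1 - i = (N - i).succ by omega]
    refine Finset.sum_congr rfl fun d _ => ?_
    have f := falling hq0 hq1 i d
    have h1 := (qfact_pos hq0 hq1 (N - i - d)).ne'
    have h2 := (qfact_pos hq0 hq1 d).ne'
    have h3 := (qfact_pos hq0 hq1 (i + d)).ne'
    rw [show N - (i + d) = N - i - d by omega]
    rw [← eq_div_iff h2] at f
    rw [f]
    field_simp
    ring
  · intro a ha
    rw [Finset.mem_Ico] at ha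
    rw [Finset.prod_eq_zero (Finset.mem_range.2 ha.2) (sub_self _)]
    simp

open Polynomial in
theorem det_poly {n : ℕ} (v : Fin n → ℝ) (p : Fin n → ℝ[X]) (hdeg : ∀ i, (p i).natDegree < n)
    (hlow : ∀ i l : Fin n, l < i → (p i).coeff l = 0) :
    (Matrix.of (fun i j => ((p j).eval (v i)))).det =
      (Matrix.vandermonde v).det * ∏ i, (p i).coeff i := by
  have h : Matrix.of (fun i j => ((p j).eval (v i))) =
    (Matrix.vandermonde v) * (Matrix.of (fun (i j : Fin n) => (p j).coeff i)) := by
    ext i j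
    rw [Matrix.mul_apply, Matrix.of_apply, eval_eq_sum_range' (hdeg j),
      ← Fin.sum_univ_eq_sum_range (fun l => (p j).coeff l * v i ^ l)]
    refine Finset.sum_congr rfl fun l _ => ?_
    simp [Matrix.vandermonde_apply, mul_comm]
  rw [h, Matrix.det_mul, Matrix.det_of_isLowerTriangular (Matrix.of (fun (i j : Fin n) => (p j).coeff i))]
  · rfl
  · intro i j hij
    exact hlow _ _ hij

open Polynomial in
theorem detG (n k N : ℕ) (hN : N + 1 = n + k) (q : ℝ) :
    (Matrix.of fun i j : Fin n => (q ^ (j : ℕ)) ^ (i : ℕ) *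
        ∏ m ∈ Finset.range (N - i), (q ^ (j : ℕ) + q ^ m)).det =
      (∏ i ∈ Finset.range n, ∏ j ∈ Finset.range k, (q ^ i + q ^ j)) *
      ((∏ i : Fin n, ∏ j ∈ Finset.Ioi i, (q ^ (j : ℕ) - q ^ (i : ℕ))) *
       ∏ i : Fin n, ∏ m ∈ Finset.range (n - 1 - i), q ^ (k + m)) := by
  let p : Fin n → ℝ[X] := fun i => X ^ (i : ℕ) * ∏ m ∈ Finset.range (n - 1 - i), (X + C (q ^ (k + m)))
  have hmon : ∀ i : Fin n, (∏ m ∈ Finset.range (n - 1 - i), (X + C (q ^ (k + m)))).natDegree = n - 1 - i := by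
    intro i
    rw [natDegree_prod_of_monic _ _ (fun m _ => monic_X_add_C _)]
    simp only [natDegree_X_add_C, Finset.sum_const, Finset.card_range, smul_eq_mul, mul_one]
  have hd := det_poly (fun j : Fin n => q ^ (j : ℕ)) p ?_ ?_
  · have hc : ∀ i : Fin n, (p i).coeff i = ∏ m ∈ Finset.range (n - 1 - i), q ^ (k + m) := by
      intro i
      have := coeff_X_pow_mul (∏ m ∈ Finset.range (n - 1 - i), (X + C (q ^ (k + m)))) (i : ℕ) 0
      rw [zero_add] at this
      simp only [p]
      rw [this, coeff_zero_eq_eval_zero, eval_prod]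
      simp
    simp only [hc] at hd
    rw [Matrix.det_vandermonde] at hd
    rw [← hd, ← Matrix.det_transpose,
      ← Fin.prod_univ_eq_prod_range (fun i => ∏ j ∈ Finset.range k, (q ^ i + q ^ j)) n,
      ← Matrix.det_mul_column]
    congr 1
    ext j i
    have hi := i.2
    simp only [Matrix.transpose_apply, Matrix.of_apply, p]
    rw [show N - (i : ℕ) = k + (n - 1 - i) by omega, Finset.prod_range_add, eval_mul, eval_prod]
    simp
    ring
  · intro i
    have hi := i.2
    have := natDegree_mul_le (p := X ^ (i : ℕ)) (q := ∏ m ∈ Finset.range (n - 1 - i), (X + C (q ^ (k + m))))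
    rw [hmon, natDegree_X_pow] at this
    simp only [p]
    omega
  · intro i l hl
    simp only [p]
    rw [coeff_X_pow_mul']
    rw [if_neg (by rw [Fin.lt_def] at hl; omega)]

open Polynomial in
theorem detP {n : ℕ} (w : Fin n → ℝ) (q : ℝ) (v : Fin n → ℝ) :
    (Matrix.of fun i j : Fin n => w j * ∏ r ∈ Finset.range i, (v j - q ^ r)).det =
     (∏ i, w i) * (Matrix.vandermonde v).det := by
  rw [Matrix.det_eval_matrixOfPolynomials_eq_det_vandermonde v
    (fun i => ∏ r ∈ Finset.range i, (X - C (q ^ r)))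
    (fun i => by
      rw [natDegree_prod_of_monic _ _ (fun m _ => monic_X_sub_C _)]
      simp only [natDegree_X_sub_C, Finset.sum_const, Finset.card_range, smul_eq_mul, mul_one])
    (fun i => monic_prod_of_monic _ _ (fun m _ => monic_X_sub_C _)),
    ← Matrix.det_mul_column, ← Matrix.det_transpose]
  congr 1
  ext i j
  simp [eval_prod]

/-- The symmetric sum, evaluated. -/
theorem sumV {q : ℝ} (hq0 : 0 < q) (hq1 : q < 1) (n k N : ℕ) (hN : N + 1 = n + k) (hk : 1 ≤ k) :
    (by classical exact ∑ s ∈ Finset.univ.filter (fun s : Fin n → Fin (N + 1) => StrictAnti s),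
      (∏ i, (q ^ ((N - (s i : ℕ)).choose 2) / (qfact q (s i) * qfact q (N - s i)))) *
        (∏ i : Fin n, ∏ j ∈ Finset.Ioi i, (q ^ (s j : ℕ) - q ^ (s i : ℕ))) ^ 2) =
      (∏ i : Fin n, (q ^ ((i : ℕ).choose 2) * (q - 1) ^ (i : ℕ) / qfact q (N - i))) *
      ((∏ i ∈ Finset.range n, ∏ j ∈ Finset.range k, (q ^ i + q ^ j)) *
      ((∏ i : Fin n, ∏ j ∈ Finset.Ioi i, (q ^ (j : ℕ) - q ^ (i : ℕ))) *
       ∏ i : Fin n, ∏ m ∈ Finset.range (n - 1 - i), q ^ (k + m))) := by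
  classical
  let P : Matrix (Fin n) (Fin (N + 1)) ℝ := Matrix.of fun i a =>
    q ^ ((N - (a : ℕ)).choose 2) / (qfact q a * qfact q (N - a)) *
       ∏ r ∈ Finset.range i, (q ^ (a : ℕ) - q ^ r)
  let R : Matrix (Fin (N + 1)) (Fin n) ℝ := Matrix.of fun a j => (q ^ (a : ℕ)) ^ (j : ℕ)
  rw [← detG n k N hN q, ← Matrix.det_mul_column]
  have e : (P * R) = Matrix.of fun i j : Fin n =>
      (q ^ ((i : ℕ).choose 2) * (q - 1) ^ (i : ℕ) / qfact q (N - i)) *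
       (Matrix.of fun i j : Fin n => (q ^ (j : ℕ)) ^ (i : ℕ) *
        ∏ m ∈ Finset.range (N - i), (q ^ (j : ℕ) + q ^ m)) i j := by
    ext i j
    rw [Matrix.mul_apply]
    exact entry hq0 hq1 N i j (by omega)
  rw [← e, cb]
  refine Finset.sum_congr (by congr) fun s _ => ?_
  have h1 := detP (fun i => q ^ ((N - (s i : ℕ)).choose 2) / (qfact q (s i) * qfact q (N - s i))) q
    (fun i => q ^ (s i : ℕ))
  have h2 : (R.submatrix s id) = Matrix.vandermonde (fun i => q ^ (s i : ℕ)) := rfl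
  have h3 : (P.submatrix id s) = (Matrix.of fun i j : Fin n =>
    (q ^ ((N - (s j : ℕ)).choose 2) / (qfact q (s j) * qfact q (N - s j))) *
      ∏ r ∈ Finset.range i, (q ^ (s j : ℕ) - q ^ r)) := rfl
  rw [h3, h2, h1, Matrix.det_vandermonde]
  ring

theorem prod_pairs {n : ℕ} (g : Fin n → Fin n → ℝ) (hd : DecidablePred fun p : Fin n × Fin n => p.1 < p.2) :
    ∏ p ∈ @Finset.filter _ (fun p : Fin n × Fin n => p.1 < p.2) hd Finset.univ, g p.1 p.2
      = ∏ i, ∏ j ∈ Finset.Ioi i, g i j := by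
  rw [Finset.prod_filter, Fintype.prod_prod_type]
  refine Finset.prod_congr rfl fun i _ => ?_
  rw [← Finset.prod_filter]
  refine Finset.prod_congr ?_ fun _ _ => rfl
  ext j
  simp

theorem prod_Ioi_left {n : ℕ} (h : Fin n → ℝ) :
    ∏ i, ∏ j ∈ Finset.Ioi i, h i = ∏ i : Fin n, h i ^ (n - 1 - (i : ℕ)) := by
  refine Finset.prod_congr rfl fun i _ => ?_
  rw [Finset.prod_const, Fin.card_Ioi]

theorem prod_Ioi_right {n : ℕ} (h : Fin n → ℝ) :
    ∏ i, ∏ j ∈ Finset.Ioi i, h j = ∏ i : Fin n, h i ^ (i : ℕ) := by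
  rw [Finset.prod_comm' (t' := Finset.univ) (s' := fun j => Finset.Iio j) (by simp)]
  refine Finset.prod_congr rfl fun i _ => ?_
  rw [Finset.prod_const, Fin.card_Iio]

theorem expo_aux (n : ℕ) : ∑ i ∈ Finset.range n, ∑ m ∈ Finset.range i, m =
    ∑ i ∈ Finset.range n, i * (n - 1 - i) := by
  induction n with
  | zero => simp
  | succ n ih =>
    rw [Finset.sum_range_succ, ih, Finset.sum_range_succ, ← Finset.sum_add_distrib]
    simp only [Nat.add_sub_cancel, Nat.sub_self, mul_zero, add_zero]
    refine Finset.sum_congr rfl fun i hi => ?_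
    rw [Finset.mem_range] at hi
    obtain ⟨d, rfl⟩ := Nat.exists_eq_add_of_lt hi
    rw [show i + d + 1 - 1 - i = d by omega, show i + d + 1 - i = d + 1 by omega]
    ring

theorem expo (n k : ℕ) (q : ℝ) :
    ∏ i : Fin n, ∏ m ∈ Finset.range (n - 1 - i), q ^ (k + m) =
      ∏ i : Fin n, (q ^ ((i : ℕ) * k) * q ^ ((i : ℕ) * (n - 1 - i))) := by
  rw [Fin.prod_univ_eq_prod_range (fun i => ∏ m ∈ Finset.range (n - 1 - i), q ^ (k + m)),
    Fin.prod_univ_eq_prod_range (fun i => q ^ ((i : ℕ) * k) * q ^ ((i : ℕ) * (n - 1 - i))),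
    Finset.prod_range_reflect (fun i => ∏ m ∈ Finset.range i, q ^ (k + m))]
  simp only [← pow_add, Finset.prod_pow_eq_pow_sum]
  congr 1
  rw [Finset.sum_add_distrib, ← expo_aux, ← Finset.sum_add_distrib]
  refine Finset.sum_congr rfl fun i _ => ?_
  rw [Finset.sum_add_distrib, Finset.sum_const, Finset.card_range, smul_eq_mul]

theorem choose_two_add (a i : ℕ) : (a + i).choose 2 = a.choose 2 + i.choose 2 + i * a := by
  induction i with
  | zero => simp
  | succ i ih => rw [← add_assoc, choose_two_succ, ih, choose_two_succ]; ring

theorem term_eq {q : ℝ} (hq0 : 0 < q) (hq1 : q < 1) (n k N : ℕ) (hN : N + 1 = n + k)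
    (lam a : Fin n → ℕ) (hl : ∀ i, lam i ≤ k) (ha : ∀ i, a i = lam i + (n - 1 - (i : ℕ)))
    (hanti : ∀ i j, i ≤ j → a j ≤ a i) :
    q ^ ((∑ i : Fin n, (i : ℕ) * lam i) + ∑ i : Fin n, (k - lam i).choose 2) *
            (∏ i : Fin n, ∏ j ∈ Finset.Ioi i, (qnum q (a i - a j)) ^ 2) *
            (∏ m ∈ Finset.range n, qfact q (k + m)) /
            ((∏ i : Fin n, ∏ j ∈ Finset.Ioi i, qnum q ((j : ℕ) - (i : ℕ))) *
              ∏ i : Fin n, (qfact q (a i) * qfact q (N - a i))) *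
      ((∏ i : Fin n, (q ^ ((i : ℕ).choose 2) * (q - 1) ^ (i : ℕ) / qfact q (N - i))) *
      ((∏ i : Fin n, ∏ j ∈ Finset.Ioi i, (q ^ (j : ℕ) - q ^ (i : ℕ))) *
       ∏ i : Fin n, ∏ m ∈ Finset.range (n - 1 - i), q ^ (k + m))) =
     (∏ i, (q ^ ((N - (a i : ℕ)).choose 2) / (qfact q (a i) * qfact q (N - a i)))) *
        (∏ i : Fin n, ∏ j ∈ Finset.Ioi i, (q ^ (a j : ℕ) - q ^ (a i : ℕ))) ^ 2 := by
  have h1q : (1 - q) ≠ 0 := by linarith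
  have hq : q ≠ 0 := hq0.ne'
  have hV : (∏ i : Fin n, ∏ j ∈ Finset.Ioi i, (q ^ (a j : ℕ) - q ^ (a i : ℕ))) =
      (∏ i : Fin n, ∏ j ∈ Finset.Ioi i, qnum q (a i - a j)) *
        (∏ i : Fin n, (q ^ a i) ^ (i : ℕ)) * ∏ i : Fin n, (1 - q) ^ (i : ℕ) := by
    rw [← prod_Ioi_right (fun i => q ^ a i), ← prod_Ioi_right (fun _ => 1 - q)]
    simp only [← Finset.prod_mul_distrib]
    refine Finset.prod_congr rfl fun i _ => Finset.prod_congr rfl fun j hj => ?_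
    obtain ⟨d, hd⟩ := Nat.exists_eq_add_of_le (hanti i j (Finset.mem_Ioi.1 hj).le)
    rw [hd, Nat.add_sub_cancel_left, qnum]
    field_simp
    ring
  have hW : (∏ i : Fin n, ∏ j ∈ Finset.Ioi i, (q ^ (j : ℕ) - q ^ (i : ℕ))) =
      (∏ i : Fin n, ∏ j ∈ Finset.Ioi i, qnum q ((j : ℕ) - (i : ℕ))) *
        (∏ i : Fin n, (q ^ (i : ℕ)) ^ (n - 1 - (i : ℕ))) * ∏ i : Fin n, (q - 1) ^ (i : ℕ) := by
    rw [← prod_Ioi_left (fun i => q ^ (i : ℕ)), ← prod_Ioi_right (fun _ => q - 1)]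
    simp only [← Finset.prod_mul_distrib]
    refine Finset.prod_congr rfl fun i _ => Finset.prod_congr rfl fun j hj => ?_
    obtain ⟨d, hd⟩ := Nat.exists_eq_add_of_le (Fin.le_def.1 (Finset.mem_Ioi.1 hj).le)
    rw [hd, Nat.add_sub_cancel_left, qnum]
    field_simp
    ring
  have hE : q ^ ((∑ i : Fin n, (i : ℕ) * lam i) + ∑ i : Fin n, (k - lam i).choose 2) *
      ((∏ i : Fin n, q ^ ((i : ℕ).choose 2)) * (∏ i : Fin n, q ^ ((i : ℕ) * k)) *
        (∏ i : Fin n, (q ^ (i : ℕ)) ^ (n - 1 - (i : ℕ))) ^ 2) =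
      (∏ i : Fin n, q ^ ((N - (a i : ℕ)).choose 2)) * (∏ i : Fin n, (q ^ a i) ^ (i : ℕ)) ^ 2 := by
    rw [pow_add, ← Finset.prod_pow_eq_pow_sum, ← Finset.prod_pow_eq_pow_sum]
    simp only [← Finset.prod_mul_distrib, ← Finset.prod_pow]
    refine Finset.prod_congr rfl fun i _ => ?_
    have hi := i.2
    obtain ⟨b, hb⟩ := Nat.exists_eq_add_of_le (hl i)
    rw [show N - a i = b + i by rw [ha]; omega, show k - lam i = b by omega, choose_two_add, ha i, hb]
    ring
  have hB : ∏ m ∈ Finset.range n, qfact q (k + m) = ∏ i : Fin n, qfact q (N - i) := by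
    rw [Fin.prod_univ_eq_prod_range (fun i => qfact q (N - i)), ← Finset.prod_range_reflect]
    refine Finset.prod_congr rfl fun i hi => ?_
    rw [Finset.mem_range] at hi
    congr 1
    omega
  have hO : (∏ i : Fin n, (q - 1) ^ (i : ℕ)) ^ 2 = (∏ i : Fin n, (1 - q) ^ (i : ℕ)) ^ 2 := by
    simp only [← Finset.prod_pow, ← pow_mul]
    refine Finset.prod_congr rfl fun i _ => ?_
    rw [mul_comm, pow_mul, pow_mul]
    congr 1
    ring
  have hD : (∏ i : Fin n, ∏ j ∈ Finset.Ioi i, qnum q ((j : ℕ) - (i : ℕ))) ≠ 0 := by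
    refine Finset.prod_ne_zero_iff.2 fun i _ => Finset.prod_ne_zero_iff.2 fun j hj => ?_
    have := Fin.lt_def.1 (Finset.mem_Ioi.1 hj)
    rw [show (j : ℕ) - i = (j - i - 1) + 1 by omega]
    exact (qnum_pos hq0 hq1 _).ne'
  have hB0 : ∏ i : Fin n, qfact q (N - i) ≠ 0 :=
    Finset.prod_ne_zero_iff.2 fun i _ => (qfact_pos hq0 hq1 _).ne'
  have hWt : ∏ i : Fin n, (qfact q (a i) * qfact q (N - a i)) ≠ 0 :=
    Finset.prod_ne_zero_iff.2 fun i _ =>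
      mul_ne_zero (qfact_pos hq0 hq1 _).ne' (qfact_pos hq0 hq1 _).ne'
  rw [hV, hW, hB, expo]
  simp only [Finset.prod_div_distrib, Finset.prod_pow, pow_mul]
  simp only [Finset.prod_mul_distrib (s := Finset.univ (α := Fin n)) (f := fun i : Fin n => q ^ ((i : ℕ).choose 2)),
    Finset.prod_mul_distrib (s := Finset.univ (α := Fin n)) (f := fun i : Fin n => (q ^ (i : ℕ)) ^ k)]
  simp only [pow_mul] at hE
  revert hE hO hD hB0 hWt
  generalize (∏ i : Fin n, (qfact q (a i) * qfact q (N - a i))) = Wt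
  generalize (∏ i : Fin n, qfact q (N - i)) = B
  generalize (∏ i : Fin n, ∏ j ∈ Finset.Ioi i, qnum q ((j : ℕ) - (i : ℕ))) = D
  generalize (∏ i : Fin n, ∏ j ∈ Finset.Ioi i, qnum q (a i - a j)) = A
  generalize (∏ i : Fin n, (q - 1) ^ (i : ℕ)) = e
  generalize (∏ i : Fin n, (1 - q) ^ (i : ℕ)) = o
  generalize (∏ i : Fin n, (q ^ (i : ℕ)) ^ (n - 1 - (i : ℕ))) = Y
  generalize (∏ i : Fin n, (q ^ (i : ℕ)) ^ k) = Z
  generalize (∏ i : Fin n, q ^ ((i : ℕ).choose 2)) = c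
  generalize (∏ i : Fin n, (q ^ a i) ^ (i : ℕ)) = x
  generalize (∏ i : Fin n, q ^ ((N - (a i : ℕ)).choose 2)) = c'
  generalize q ^ ((∑ i : Fin n, (i : ℕ) * lam i) + ∑ i : Fin n, (k - lam i).choose 2) = E
  intro hO hD hB0 hWt hE
  field_simp
  linear_combination (A ^ 2 * e ^ 2) * hE + (A ^ 2 * c' * x ^ 2) * hO

open Classical in
/-- Normalizing constant identity: the sum over partitions in the n×k rectangle
(encoded as antitone functions Fin n → Fin (k+1), with a_i = λ_i + n - i) of the
unnormalized q-Krawtchouk ensemble weights equals ∏ (q^{i-1} + q^{j-1}). -/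
theorem stmt16 (n k : ℕ) (hn : 1 ≤ n) (hk : 1 ≤ k) (q : ℝ) (hq0 : 0 < q) (hq1 : q < 1) :
    (∑ f ∈ Finset.univ.filter
        (fun f : Fin n → Fin (k + 1) => Antitone fun i => ((f i : ℕ))),
      (fun lam : Fin n → ℕ =>
        (fun a : Fin n → ℕ =>
          q ^ ((∑ i : Fin n, (i : ℕ) * lam i) + ∑ i : Fin n, (k - lam i).choose 2) *
            (∏ p ∈ Finset.univ.filter (fun p : Fin n × Fin n => p.1 < p.2),
              (qnum q (a p.1 - a p.2)) ^ 2) *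
            (∏ m ∈ Finset.range n, qfact q (k + m)) /
            ((∏ p ∈ Finset.univ.filter (fun p : Fin n × Fin n => p.1 < p.2),
                qnum q ((p.2 : ℕ) - (p.1 : ℕ))) *
              ∏ i : Fin n, (qfact q (a i) * qfact q (n + k - 1 - a i))))
          (fun i => lam i + (n - 1 - (i : ℕ)))) (fun i => (f i : ℕ))) =
      ∏ i ∈ Finset.range n, ∏ j ∈ Finset.range k, (q ^ i + q ^ j) := by
  classical
  obtain ⟨N, hN⟩ : ∃ N, N + 1 = n + k := ⟨n + k - 1, by omega⟩
  have hNN : n + k - 1 = N := by omega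
  set T : ℝ := ((∏ i : Fin n, (q ^ ((i : ℕ).choose 2) * (q - 1) ^ (i : ℕ) / qfact q (N - i))) *
      ((∏ i : Fin n, ∏ j ∈ Finset.Ioi i, (q ^ (j : ℕ) - q ^ (i : ℕ))) *
       ∏ i : Fin n, ∏ m ∈ Finset.range (n - 1 - i), q ^ (k + m))) with hT
  have hT0 : T ≠ 0 := by
    rw [hT]
    refine mul_ne_zero (Finset.prod_ne_zero_iff.2 fun i _ => ?_) (mul_ne_zero
      (Finset.prod_ne_zero_iff.2 fun i _ => Finset.prod_ne_zero_iff.2 fun j hj => ?_)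
      (Finset.prod_ne_zero_iff.2 fun i _ => Finset.prod_ne_zero_iff.2 fun j _ => ?_))
    · exact div_ne_zero (mul_ne_zero (pow_ne_zero _ hq0.ne')
        (pow_ne_zero _ (by linarith))) (qfact_pos hq0 hq1 _).ne'
    · have := pow_lt_pow_right_of_lt_one₀ hq0 hq1 (Fin.lt_def.1 (Finset.mem_Ioi.1 hj))
      linarith
    · exact pow_ne_zero _ hq0.ne'
  apply mul_right_cancel₀ hT0
  rw [Finset.sum_mul]
  have hs := sumV hq0 hq1 n k N hN hk
  have hr := reindex n k N hN (fun a : Fin n → ℕ =>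
    (∏ i, (q ^ ((N - (a i : ℕ)).choose 2) / (qfact q (a i) * qfact q (N - a i)))) *
        (∏ i : Fin n, ∏ j ∈ Finset.Ioi i, (q ^ (a j : ℕ) - q ^ (a i : ℕ))) ^ 2)
  have goal2 : ∀ S : ℝ, S = (∏ i : Fin n, (q ^ ((i : ℕ).choose 2) * (q - 1) ^ (i : ℕ) / qfact q (N - i))) *
      ((∏ i ∈ Finset.range n, ∏ j ∈ Finset.range k, (q ^ i + q ^ j)) *
      ((∏ i : Fin n, ∏ j ∈ Finset.Ioi i, (q ^ (j : ℕ) - q ^ (i : ℕ))) *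
       ∏ i : Fin n, ∏ m ∈ Finset.range (n - 1 - i), q ^ (k + m))) →
       S = (∏ i ∈ Finset.range n, ∏ j ∈ Finset.range k, (q ^ i + q ^ j)) * T := by
    intro S hS
    rw [hS, hT]
    ring
  apply goal2
  rw [← hs]
  refine Eq.trans ?_ hr
  refine Finset.sum_congr rfl fun f hf => ?_
  have hf' : Antitone fun i => ((f i : ℕ)) := (Finset.mem_filter.1 hf).2
  have ht := term_eq hq0 hq1 n k N hN (fun i => (f i : ℕ)) (fun i => f i + (n - 1 - (i : ℕ)))
    (fun i => by have := (f i).2; omega) (fun i => rfl)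
    (fun i j hij => by
      have := hf' hij
      have := Fin.le_def.1 hij
      simp only at *
      omega)
  rw [← ht, ← hT, hNN]
  simp only [prod_pairs (fun i j : Fin n => (qnum q (((f i : ℕ) + (n - 1 - (i : ℕ))) - ((f j : ℕ) + (n - 1 - (j : ℕ))))) ^ 2),
    prod_pairs (fun i j : Fin n => qnum q ((j : ℕ) - (i : ℕ)))]
end
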